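/- Let S and T be invertible commuting measure-preserving transformations of a probability space (X, 𝒮, μ) forming a strong mixing ℤ²-action, i.e., μ(T^n S^m A ∩ B) → μ(A)μ(B) for all A, B ∈ 𝒮 as |m| + |n| → ∞. Let C ∈ 𝒮 satisfy μ(C) = 1/2, set C_i = S^i C for i ∈ ℕ, and let C = {C_i : i ∈ ℕ}. Then H_μ(C) = log₂ 2 = 1 > 0, and nevertheless T is uniformly mixing over C: lim_{n→∞} sup_{i,j ∈ ℕ} |μ(T^n C_i ∩ C_j) − μ(C_i) μ(C_j)| = 0. -/

import Mathlib

open MeasureTheory Filter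

/-- Entropy (base 2) of the join of the sets `C 0, …, C (n-1)`: the cells of the join are
indexed by sign patterns `s : Fin n → Bool`; cells of measure zero contribute `0`. -/
noncomputable def joinEntropy {X : Type*} [MeasurableSpace X] (μ : Measure X)
    {n : ℕ} (C : Fin n → Set X) : ℝ :=
  ∑ s : Fin n → Bool,
    -((μ (⋂ i, if s i then C i else (C i)ᶜ)).toReal *
      Real.logb 2 (μ (⋂ i, if s i then C i else (C i)ᶜ)).toReal)

/-- Entropy of a family `𝒞` of measurable sets: the supremum over all sequences of sets
from `𝒞` of `liminf (1/n) H_μ(⋁_{i<n} C_i)`. -/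
noncomputable def famEntropy {X : Type*} [MeasurableSpace X] (μ : Measure X)
    (𝒞 : Set (Set X)) : ℝ :=
  ⨆ S : {f : ℕ → Set X // ∀ i, f i ∈ 𝒞},
    Filter.liminf (fun n : ℕ => joinEntropy μ (fun i : Fin n => S.1 i) / n) Filter.atTop

/-- The mean deviation `∫ |(1/n) ∑_{i<n} 1_C(T^i x) − μ(C)| dμ` of the Birkhoff average. -/
noncomputable def birkDev {X : Type*} [MeasurableSpace X] (μ : Measure X)
    (T : X → X) (C : Set X) (n : ℕ) : ℝ :=
  ∫ x, |(∑ i ∈ Finset.range n, C.indicator (fun _ => (1 : ℝ)) (T^[i] x)) / n - (μ C).toReal| ∂μ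

/-- The `n`-th integer iterate of an invertible transformation. -/
def zIter {X : Type*} [MeasurableSpace X] (T : X ≃ᵐ X) (n : ℤ) : X → X :=
  if 0 ≤ n then (⇑T)^[n.toNat] else (⇑T.symm)^[(-n).toNat]


lemma aux_emb {X : Type*} [MeasurableSpace X] (S : X ≃ᵐ X) (i : ℕ) :
    MeasurableEmbedding ((⇑S)^[i]) := by
  induction i with
  | zero => simpa using MeasurableEmbedding.id
  | succ k ih =>
    rw [Function.iterate_succ]
    exact ih.comp S.measurableEmbedding

lemma aux_image {X : Type*} [MeasurableSpace X] (μ : Measure X) (S : X ≃ᵐ X)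
    (hS : MeasurePreserving (⇑S) μ μ) (i : ℕ) (A : Set X) :
    μ ((⇑S)^[i] '' A) = μ A := by
  have h := (hS.iterate i).measure_preimage_emb (aux_emb S i) ((⇑S)^[i] '' A)
  rw [Set.preimage_image_eq _ (aux_emb S i).injective] at h
  exact h.symm

lemma aux_z {X : Type*} [MeasurableSpace X] (S : X ≃ᵐ X) (i j : ℕ) (x : X) :
    (⇑S)^[j] (zIter S ((i : ℤ) - j) x) = (⇑S)^[i] x := by
  unfold zIter
  split_ifs with h
  · rw [← Function.iterate_add_apply]
    congr 2
    omega
  · have : (-((i : ℤ) - j)).toNat = j - i := by omega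
    rw [this]
    have hj : j = i + (j - i) := by omega
    conv_lhs => rw [hj, Function.iterate_add_apply]
    congr 1
    have := Function.LeftInverse.iterate (f := ⇑S.symm) (g := ⇑S) (fun x => by simp) (j - i) x
    simpa using this

lemma aux_zn {X : Type*} [MeasurableSpace X] (S : X ≃ᵐ X) (i : ℕ) :
    zIter S (i : ℤ) = (⇑S)^[i] := by
  simp [zIter]

lemma aux_shift {X : Type*} [MeasurableSpace X] (μ : Measure X) (S T : X ≃ᵐ X)
    (hS : MeasurePreserving (⇑S) μ μ)
    (hcomm : ∀ x, S (T x) = T (S x)) (C : Set X) (n i j : ℕ) :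
    μ ((⇑T)^[n] '' ((⇑S)^[i] '' C) ∩ ((⇑S)^[j] '' C)) =
    μ (zIter T n '' (zIter S ((i : ℤ) - j) '' C) ∩ C) := by
  rw [← aux_image μ S hS j (zIter T n '' (zIter S ((i : ℤ) - j) '' C) ∩ C),
    Set.image_inter (aux_emb S j).injective, aux_zn]
  congr 2
  rw [Set.image_image, Set.image_image, Set.image_image]
  apply Set.image_congr
  intro x _
  have hc : Function.Commute (⇑S) (⇑T) := hcomm
  rw [(hc.iterate_iterate j n).eq, aux_z]

/-- cell -/
def cellOf {X : Type*} {n : ℕ} (C : Fin n → Set X) (s : Fin n → Bool) : Set X :=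
  ⋂ i, if s i then C i else (C i)ᶜ

lemma cellOf_meas {X : Type*} [MeasurableSpace X] {n : ℕ} (C : Fin n → Set X)
    (hC : ∀ i, MeasurableSet (C i)) (s : Fin n → Bool) : MeasurableSet (cellOf C s) := by
  apply MeasurableSet.iInter
  intro i
  split_ifs
  · exact hC i
  · exact (hC i).compl

lemma cellOf_sum {X : Type*} [MeasurableSpace X] (μ : Measure X) [IsProbabilityMeasure μ]
    {n : ℕ} (C : Fin n → Set X) (hC : ∀ i, MeasurableSet (C i)) :
    ∑ s, (μ (cellOf C s)).toReal = 1 := by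
  classical
  have hd : Pairwise (Function.onFun Disjoint (cellOf C)) := by
    intro s t hst
    rw [Function.onFun, Set.disjoint_left]
    intro x hx hy
    apply hst
    funext i
    have h1 := Set.mem_iInter.1 hx i
    have h2 := Set.mem_iInter.1 hy i
    cases hs : s i <;> cases ht : t i <;> simp_all
  have hu : (⋃ s, cellOf C s) = Set.univ := by
    rw [Set.eq_univ_iff_forall]
    intro x
    refine Set.mem_iUnion.2 ⟨fun i => decide (x ∈ C i), Set.mem_iInter.2 fun i => ?_⟩
    by_cases h : x ∈ C i <;> simp [h]
  have := measure_iUnion (μ := μ) hd (cellOf_meas C hC)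
  rw [hu, measure_univ, tsum_fintype] at this
  rw [← ENNReal.toReal_sum (fun s _ => measure_ne_top _ _), ← this]
  simp

lemma jE_eq {X : Type*} [MeasurableSpace X] (μ : Measure X) {n : ℕ} (C : Fin n → Set X) :
    joinEntropy μ C =
      ∑ s, -((μ (cellOf C s)).toReal * Real.logb 2 (μ (cellOf C s)).toReal) := rfl

lemma p_le {X : Type*} [MeasurableSpace X] (μ : Measure X) [IsProbabilityMeasure μ]
    (A : Set X) : (μ A).toReal ≤ 1 := measureReal_le_one

lemma jE_nonneg {X : Type*} [MeasurableSpace X] (μ : Measure X) [IsProbabilityMeasure μ]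
    {n : ℕ} (C : Fin n → Set X) : 0 ≤ joinEntropy μ C := by
  rw [jE_eq]
  apply Finset.sum_nonneg
  intro s _
  have : Real.logb 2 (μ (cellOf C s)).toReal ≤ 0 :=
    Real.logb_nonpos (by norm_num) ENNReal.toReal_nonneg (p_le _ _)
  have h2 : 0 ≤ (μ (cellOf C s)).toReal := ENNReal.toReal_nonneg
  nlinarith

lemma jE_le {X : Type*} [MeasurableSpace X] (μ : Measure X) [IsProbabilityMeasure μ]
    {n : ℕ} (C : Fin n → Set X) (hC : ∀ i, MeasurableSet (C i)) : joinEntropy μ C ≤ n := by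
  have hl : 0 < Real.log 2 := Real.log_pos (by norm_num)
  have key : ∀ p : ℝ, 0 ≤ p → -(p * Real.logb 2 p) ≤ p * n + ((1/2)^n - p) / Real.log 2 := by
    intro p hp
    rcases hp.eq_or_lt with rfl | hp
    · simp; positivity
    have h := Real.log_le_sub_one_of_pos (x := (1/2)^n / p) (by positivity)
    rw [Real.log_div (by positivity) hp.ne', Real.log_pow, one_div, Real.log_inv] at h
    have h3 : p * (n * -Real.log 2 - Real.log p) ≤ p * ((2⁻¹)^n / p - 1) := by gcongr
    have h4 : p * ((2⁻¹)^n / p - 1) = (2⁻¹:ℝ)^n - p := by field_simp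
    rw [h4] at h3
    rw [Real.logb, one_div]
    have h5 : -(p * (Real.log p / Real.log 2)) - p * n =
      (p * (n * -Real.log 2 - Real.log p)) / Real.log 2 := by field_simp; ring
    have h6 := div_le_div_of_nonneg_right h3 hl.le
    linarith
  rw [jE_eq]
  refine (Finset.sum_le_sum fun s _ => key _ ENNReal.toReal_nonneg).trans ?_
  rw [Finset.sum_add_distrib, ← Finset.sum_mul, ← Finset.sum_div, Finset.sum_sub_distrib,
    cellOf_sum μ C hC]
  simp

lemma jE_ge {X : Type*} [MeasurableSpace X] (μ : Measure X) [IsProbabilityMeasure μ]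
    {n : ℕ} (C : Fin n → Set X) (hC : ∀ i, MeasurableSet (C i))
    (h : ∀ s, (μ (cellOf C s)).toReal < 2 * (1/2)^n) : (n : ℝ) - 1 ≤ joinEntropy μ C := by
  have key : ∀ p : ℝ, 0 ≤ p → p < 2 * (1/2)^n → p * ((n:ℝ) - 1) ≤ -(p * Real.logb 2 p) := by
    intro p hp h
    rcases hp.eq_or_lt with rfl | hp
    · simp
    have h1 : Real.logb 2 p ≤ Real.logb 2 (2 * (1/2)^n) :=
      Real.logb_le_logb_of_le (by norm_num) hp h.le
    rw [Real.logb_mul (by norm_num) (by positivity), Real.logb_pow, one_div, Real.logb_inv,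
      Real.logb_self_eq_one (by norm_num)] at h1
    nlinarith
  rw [jE_eq]
  refine le_trans ?_ (Finset.sum_le_sum fun s _ => key _ ENNReal.toReal_nonneg (h s))
  rw [← Finset.sum_mul, cellOf_sum μ C hC, one_mul]

lemma cellOf_succ {X : Type*} {n : ℕ} (D : ℕ → Set X) (s : Fin (n+1) → Bool) :
    cellOf (fun i : Fin (n+1) => D i) s =
      cellOf (fun i : Fin n => D i) (fun i => s i.castSucc) ∩
        (if s (Fin.last n) then D n else (D n)ᶜ) := by
  ext x
  simp only [cellOf, Set.mem_iInter, Set.mem_inter_iff, Fin.forall_fin_succ', Fin.val_castSucc,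
    Fin.val_last]

/-- greedy construction -/
lemma exists_greedy (P : ∀ n : ℕ, (ℕ → ℕ) → Prop)
    (hloc : ∀ n f g, (∀ i < n, f i = g i) → P n f → P n g)
    (h0 : ∀ f, P 0 f)
    (hs : ∀ n f, P n f → ∃ a, P (n+1) (Function.update f n a)) :
    ∃ g, ∀ n, P n g := by
  classical
  have hs' : ∀ n f, ∃ a, P n f → P (n+1) (Function.update f n a) := by
    intro n f
    by_cases h : P n f
    · obtain ⟨a, ha⟩ := hs n f h
      exact ⟨a, fun _ => ha⟩
    · exact ⟨0, fun h' => absurd h' h⟩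
  choose a ha using hs'
  let H : ℕ → (ℕ → ℕ) := fun n => Nat.rec (fun _ => 0) (fun n f => Function.update f n (a n f)) n
  have Hs : ∀ n, H (n+1) = Function.update (H n) n (a n (H n)) := fun n => rfl
  have hP : ∀ n, P n (H n) := by
    intro n
    induction n with
    | zero => exact h0 _
    | succ k ih => rw [Hs]; exact ha _ _ ih
  have hst : ∀ n i, i < n → H n i = H (i+1) i := by
    intro n i hi
    induction n with
    | zero => omega
    | succ k ih =>
      rcases Nat.lt_succ_iff_lt_or_eq.1 hi with h | h
      · rw [Hs, Function.update_of_ne h.ne, ih h]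
      · rw [h]
  exact ⟨fun i => H (i+1) i, fun n => hloc n _ _ (fun i hi => hst n i hi) (hP n)⟩

lemma exists_seq_good {X : Type*} [MeasurableSpace X] (μ : Measure X) [IsProbabilityMeasure μ]
    (D : ℕ → Set X) (hD : ∀ i, MeasurableSet (D i))
    (hmix : ∀ B, MeasurableSet B → ∀ ε > (0:ℝ), ∃ K : ℕ, ∀ m ≥ K,
      |(μ (D m ∩ B)).toReal - 1/2 * (μ B).toReal| < ε) :
    ∃ g : ℕ → ℕ, ∀ n, ∀ s, (μ (cellOf (fun i : Fin n => D (g i)) s)).toReal < 2 * (1/2)^n := by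
  apply exists_greedy (fun n g => ∀ s, (μ (cellOf (fun i : Fin n => D (g i)) s)).toReal
    < 2 * (1/2)^n)
  · intro n f g h hf
    have : (fun i : Fin n => D (g i)) = fun i : Fin n => D (f i) := by
      funext i; rw [h i i.2]
    rw [this]; exact hf
  · intro f s
    have := p_le μ (cellOf (fun i : Fin 0 => D (f i)) s)
    norm_num
    linarith
  · intro n f hf
    have hB : ∀ s, MeasurableSet (cellOf (fun i : Fin n => D (f i)) s) :=
      fun s => cellOf_meas _ (fun i => hD _) s
    choose K hK using fun s => hmix _ (hB s)
      ((2 * (1/2)^n - (μ (cellOf (fun i : Fin n => D (f i)) s)).toReal) / 2)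
      (by have := hf s; linarith)
    refine ⟨Finset.univ.sup K, fun s => ?_⟩
    set a := Finset.univ.sup K
    rw [cellOf_succ (fun i => D (Function.update f n a i))]
    have e : (fun i : Fin n => D (Function.update f n a i)) = fun i : Fin n => D (f i) := by
      funext i; rw [Function.update_of_ne i.2.ne]
    simp only [e, Function.update_self]
    have h := hK (fun i => s i.castSucc) a (Finset.le_sup (Finset.mem_univ _))
    set B := cellOf (fun i : Fin n => D (f i)) (fun i => s i.castSucc)
    have hadd : (μ (B ∩ D a)).toReal + (μ (B ∩ (D a)ᶜ)).toReal = (μ B).toReal := by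
      rw [← Set.sdiff_eq]
      exact measureReal_inter_add_sdiff (hD a)
    rw [Set.inter_comm, abs_lt] at h
    rw [pow_succ]
    split_ifs <;> linarith

lemma fam_eq_one {X : Type*} [MeasurableSpace X] (μ : Measure X) [IsProbabilityMeasure μ]
    (D : ℕ → Set X) (hD : ∀ i, MeasurableSet (D i))
    (hmix : ∀ B, MeasurableSet B → ∀ ε > (0:ℝ), ∃ K : ℕ, ∀ m ≥ K,
      |(μ (D m ∩ B)).toReal - 1/2 * (μ B).toReal| < ε) :
    famEntropy μ {A : Set X | ∃ i : ℕ, A = D i} = 1 := by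
  obtain ⟨g, hg⟩ := exists_seq_good μ D hD hmix
  have hm : ∀ F : {f : ℕ → Set X // ∀ i, f i ∈ {A : Set X | ∃ i : ℕ, A = D i}},
      ∀ i, MeasurableSet (F.1 i) := by
    intro F i
    obtain ⟨k, hk⟩ := F.2 i
    rw [hk]; exact hD k
  have hu : ∀ F : {f : ℕ → Set X // ∀ i, f i ∈ {A : Set X | ∃ i : ℕ, A = D i}}, ∀ n : ℕ,
      joinEntropy μ (fun i : Fin n => F.1 i) / n ≤ 1 := by
    intro F n
    exact div_le_one_of_le₀ (jE_le μ _ (fun i => hm F i)) (Nat.cast_nonneg n)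
  have hle : ∀ F : {f : ℕ → Set X // ∀ i, f i ∈ {A : Set X | ∃ i : ℕ, A = D i}},
      Filter.liminf (fun n : ℕ => joinEntropy μ (fun i : Fin n => F.1 i) / n) atTop ≤ 1 := by
    intro F
    apply Filter.liminf_le_of_frequently_le
    · exact Frequently.of_forall (hu F)
    · exact ⟨0, by
        simp only [eventually_map]
        exact Eventually.of_forall fun n => div_nonneg (jE_nonneg μ _) (Nat.cast_nonneg n)⟩
  let F₀ : {f : ℕ → Set X // ∀ i, f i ∈ {A : Set X | ∃ i : ℕ, A = D i}} :=
    ⟨fun i => D (g i), fun i => ⟨g i, rfl⟩⟩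
  have hlim : Tendsto (fun n : ℕ => joinEntropy μ (fun i : Fin n => F₀.1 i) / n) atTop
      (nhds 1) := by
    have h1 : Tendsto (fun n : ℕ => 1 - 1 / (n : ℝ)) atTop (nhds 1) := by
      simpa using (tendsto_const_nhds (x := (1:ℝ))).sub (tendsto_one_div_atTop_nhds_zero_nat (𝕜 := ℝ))
    refine tendsto_of_tendsto_of_tendsto_of_le_of_le' h1 tendsto_const_nhds ?_
      (Eventually.of_forall (hu F₀))
    filter_upwards [eventually_gt_atTop 0] with n hn
    have hn' : (0:ℝ) < n := by exact_mod_cast hn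
    rw [le_div_iff₀ hn']
    have := jE_ge μ (fun i : Fin n => F₀.1 i) (fun i => hm F₀ i) (hg n)
    field_simp
    linarith
  have : Nonempty {f : ℕ → Set X // ∀ i, f i ∈ {A : Set X | ∃ i : ℕ, A = D i}} := ⟨F₀⟩
  apply le_antisymm
  · exact ciSup_le hle
  · have := le_ciSup (f := fun F : {f : ℕ → Set X // ∀ i, f i ∈ {A : Set X | ∃ i : ℕ, A = D i}} =>
      Filter.liminf (fun n : ℕ => joinEntropy μ (fun i : Fin n => F.1 i) / n) atTop)
      ⟨1, by rintro _ ⟨F, rfl⟩; exact hle F⟩ F₀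
    simp only [hlim.liminf_eq] at this
    exact this

/-- If `S, T` are invertible commuting measure preserving transformations forming a strong
mixing `ℤ²`-action, `μ C = 1/2` and `C_i = SⁱC`, then the family `𝒞 = {C_i : i ∈ ℕ}` has
entropy `log₂ 2 = 1 > 0` and yet `T` is uniformly mixing over `𝒞`. -/
theorem pos_entropy_family_uniformly_mixing
    {X : Type*} [MeasurableSpace X] (μ : Measure X) [IsProbabilityMeasure μ]
    (S T : X ≃ᵐ X)
    (hS : MeasurePreserving (⇑S) μ μ) (hT : MeasurePreserving (⇑T) μ μ)
    (hcomm : ∀ x, S (T x) = T (S x))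
    (hmix : ∀ A B : Set X, MeasurableSet A → MeasurableSet B →
      ∀ ε > (0 : ℝ), ∃ K : ℕ, ∀ m n : ℤ, (K : ℤ) ≤ |m| + |n| →
        |(μ (zIter T n '' (zIter S m '' A) ∩ B)).toReal -
          (μ A).toReal * (μ B).toReal| < ε)
    (C : Set X) (hC : MeasurableSet C) (hChalf : μ C = 1 / 2) :
    famEntropy μ {A : Set X | ∃ i : ℕ, A = (⇑S)^[i] '' C} = 1 ∧
    Tendsto
      (fun n : ℕ => ⨆ i : ℕ, ⨆ j : ℕ,
        |(μ ((⇑T)^[n] '' ((⇑S)^[i] '' C) ∩ ((⇑S)^[j] '' C))).toReal -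
          (μ ((⇑S)^[i] '' C)).toReal * (μ ((⇑S)^[j] '' C)).toReal|)
      atTop (nhds 0) := by
  have hh : (μ C).toReal = 1/2 := by rw [hChalf]; simp
  constructor
  · refine fam_eq_one μ (fun i => (⇑S)^[i] '' C)
      (fun i => (aux_emb S i).measurableSet_image.2 hC) ?_
    intro B hB ε hε
    obtain ⟨K, hK⟩ := hmix C B hC hB ε hε
    refine ⟨K, fun m hm => ?_⟩
    have := hK m 0 (by simpa using hm)
    have e : zIter T 0 = id := by simp [zIter]
    rwa [aux_zn, e, Set.image_id, hh] at this
  · rw [Metric.tendsto_atTop]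
    intro ε hε
    obtain ⟨K, hK⟩ := hmix C C hC hC (ε/2) (by linarith)
    refine ⟨K, fun n hn => ?_⟩
    have hb : ∀ i j : ℕ, |(μ ((⇑T)^[n] '' ((⇑S)^[i] '' C) ∩ ((⇑S)^[j] '' C))).toReal -
          (μ ((⇑S)^[i] '' C)).toReal * (μ ((⇑S)^[j] '' C)).toReal| ≤ ε / 2 := by
      intro i j
      rw [aux_shift μ S T hS hcomm, aux_image μ S hS, aux_image μ S hS]
      refine (hK _ _ ?_).le
      have : |(n:ℤ)| = n := by simp
      have := abs_nonneg ((i:ℤ) - j)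
      omega
    rw [Real.dist_eq, sub_zero, abs_of_nonneg
      (Real.iSup_nonneg fun i => Real.iSup_nonneg fun j => abs_nonneg _)]
    have := ciSup_le fun i => ciSup_le fun j => hb i j
    linarith
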